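/- arXiv:1512.09067 — 2 statements merged into one kernel-verified Lean document; each statement's English description precedes it below -/
import Mathlib

section
/- Let z ∈ ℂ∖[0,∞) and a ∈ [0,∞). Then the function t ↦ (a + t² − z)^{−1} is integrable on ℝ and (1/(2π)) ∫_ℝ (a + t² − z)^{−1} dt = (1/2) (a − z)^{−1/2}, where (a−z)^{−1/2} = exp(−(1/2) Log(a−z)) with Log the principal branch of the logarithm on ℂ∖(−∞,0]. -/
open MeasureTheory Complex Filter Real

noncomputable section

/-- If `Re s > 0`, then `t ↦ (s² + t²)⁻¹` is integrable on the real line. -/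
theorem integrable_inv_sq_add_sq_of_re_pos {s : ℂ} (hs : 0 < s.re) :
    Integrable (fun t : ℝ => (s ^ 2 + (t : ℂ) ^ 2)⁻¹) := by
  have hlower (t : ℝ) : s.re ^ 2 ≤ ‖s ^ 2 + (t : ℂ) ^ 2‖ := by
    have hfactor : s ^ 2 + (t : ℂ) ^ 2 = (s + t * I) * (s - t * I) := by
      linear_combination (t : ℂ) ^ 2 * I_sq
    have hplus : s.re ≤ ‖s + t * I‖ := by simpa using re_le_norm (s + t * I)
    have hminus : s.re ≤ ‖s - t * I‖ := by simpa using re_le_norm (s - t * I)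
    rw [hfactor, norm_mul, sq]
    gcongr
  have hpos : 0 < s.re ^ 2 := by positivity
  have hne (t : ℝ) : s ^ 2 + (t : ℂ) ^ 2 ≠ 0 := norm_pos_iff.mp (hpos.trans_le (hlower t))
  refine (integrable_inv_one_add_sq.const_mul (1 + ‖1 - s ^ 2‖ / s.re ^ 2)).mono' ?_ ?_
  · exact (Continuous.inv₀ (by fun_prop) hne).aestronglyMeasurable
  · filter_upwards with t
    have hN := hpos.trans_le (hlower t)
    have hnum : 1 + t ^ 2 ≤ ‖s ^ 2 + (t : ℂ) ^ 2‖ + ‖1 - s ^ 2‖ := by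
      have h := norm_add_le (s ^ 2 + (t : ℂ) ^ 2) (1 - s ^ 2)
      have heq : s ^ 2 + (t : ℂ) ^ 2 + (1 - s ^ 2) = ((1 + t ^ 2 : ℝ) : ℂ) := by
        push_cast; ring
      rwa [heq, Complex.norm_of_nonneg (by positivity)] at h
    have hquot : ‖1 - s ^ 2‖ ≤ ‖1 - s ^ 2‖ / s.re ^ 2 * ‖s ^ 2 + (t : ℂ) ^ 2‖ := by
      rw [div_mul_eq_mul_div, le_div_iff₀ hpos]
      gcongr
      exact hlower t
    rw [norm_inv, ← div_eq_mul_inv, inv_eq_one_div, div_le_div_iff₀ hN (by positivity)]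
    linarith

theorem tendsto_log_add_mul_I_sub_log_sub_mul_I (s : ℂ) :
    Tendsto (fun t : ℝ => log (s + t * I) - log (s - t * I)) atTop (nhds (π * I)) := by
  have hdiv : Tendsto (fun t : ℝ => s * ((t⁻¹ : ℝ) : ℂ)) atTop (nhds 0) := by
    simpa using ((continuous_ofReal.tendsto 0).comp tendsto_inv_atTop_zero).const_mul s
  have hplus := (hdiv.add_const I).clog (by simp [mem_slitPlane_iff])
  have hminus := (hdiv.sub_const I).clog (by simp [mem_slitPlane_iff])
  have hval : log (0 + I) - log (0 - I) = π * I := by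
    simp only [zero_add, zero_sub, log_I, log_neg_I]
    ring
  refine (hval ▸ hplus.sub hminus).congr' ?_
  filter_upwards [eventually_gt_atTop 0,
    (hdiv.add_const I).eventually_ne (b₂ := 0) (by simp),
    (hdiv.sub_const I).eventually_ne (b₂ := 0) (by simp)] with t ht hp hm
  have htc : (t : ℂ) ≠ 0 := ofReal_ne_zero.mpr ht.ne'
  have hep : s + t * I = t * (s * ((t⁻¹ : ℝ) : ℂ) + I) := by push_cast; field_simp
  have hem : s - t * I = t * (s * ((t⁻¹ : ℝ) : ℂ) - I) := by push_cast; field_simp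
  rw [hep, hem, log_ofReal_mul ht hp, log_ofReal_mul ht hm]
  ring

theorem integral_univ_inv_sq_add_sq_of_re_pos {s : ℂ} (hs : 0 < s.re) :
    ∫ t : ℝ, (s ^ 2 + (t : ℂ) ^ 2)⁻¹ = π / s := by
  have hs0 : s ≠ 0 := by rintro rfl; simp at hs
  have hplus (t : ℝ) : s + t * I ∈ slitPlane := by simp [mem_slitPlane_iff, hs]
  have hminus (t : ℝ) : s - t * I ∈ slitPlane := by simp [mem_slitPlane_iff, hs]
  have hderiv (t : ℝ) : HasDerivAt
      (fun t : ℝ => (2 * s * I)⁻¹ * (log (s + t * I) - log (s - t * I)))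
      (s ^ 2 + (t : ℂ) ^ 2)⁻¹ t := by
    have hlin : HasDerivAt (fun t : ℝ => (t : ℂ) * I) I t := by
      simpa using (hasDerivAt_id t).ofReal_comp.mul_const I
    have h := (((hlin.const_add s).clog_real (hplus t)).sub
      ((hlin.const_sub s).clog_real (hminus t))).const_mul (2 * s * I)⁻¹
    refine h.congr_deriv ?_
    have hp := slitPlane_ne_zero (hplus t)
    have hm := slitPlane_ne_zero (hminus t)
    have hfactor : s ^ 2 + (t : ℂ) ^ 2 = (s + t * I) * (s - t * I) := by
      linear_combination (t : ℂ) ^ 2 * I_sq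
    have hsum : (s + t * I) + (s - t * I) = 2 * s := by ring
    rw [hfactor]
    generalize s + t * I = p, s - t * I = m at hp hm hsum ⊢
    field_simp
    linear_combination hsum
  have htop := (tendsto_log_add_mul_I_sub_log_sub_mul_I s).const_mul (2 * s * I)⁻¹
  have hbot : Tendsto (fun t : ℝ => (2 * s * I)⁻¹ * (log (s + t * I) - log (s - t * I))) atBot
      (nhds (-((2 * s * I)⁻¹ * (π * I)))) := by
    refine (htop.neg.comp tendsto_neg_atBot_atTop).congr fun t => ?_
    simp only [Function.comp_apply, ofReal_neg, neg_mul, sub_neg_eq_add, ← sub_eq_add_neg]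
    ring
  rw [integral_of_hasDerivAt_of_tendsto hderiv (integrable_inv_sq_add_sq_of_re_pos hs) hbot htop]
  field_simp
  ring

/-- For `z ∈ ℂ \ [0,∞)` and `a ≥ 0`, the function `t ↦ (a + t² - z)⁻¹` is integrable on `ℝ` and
`(1/(2π)) ∫_ℝ (a + t² - z)⁻¹ dt = (1/2)(a - z)^{-1/2}`, with the principal branch power. -/
theorem statement7 (z : ℂ) (hz : ¬ (z.im = 0 ∧ 0 ≤ z.re)) (a : ℝ) (ha : 0 ≤ a) :
    Integrable (fun t : ℝ => ((a : ℂ) + (t : ℂ)^2 - z)⁻¹) (volume : Measure ℝ) ∧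
      (1 / (2 * (π : ℂ))) * ∫ t : ℝ, ((a : ℂ) + (t : ℂ)^2 - z)⁻¹
        = (1/2 : ℂ) * ((a : ℂ) - z) ^ (-(1/2) : ℂ) := by
  have hslit : (a : ℂ) - z ∈ slitPlane := by
    rw [mem_slitPlane_iff]
    by_contra! h
    simp only [sub_re, ofReal_re, sub_im, ofReal_im, zero_sub, neg_eq_zero] at h
    exact hz ⟨h.2, by linarith [h.1]⟩
  have hne := slitPlane_ne_zero hslit
  set s : ℂ := ((a : ℂ) - z) ^ (1 / 2 : ℂ) with hsdef
  have hsq : s ^ 2 = (a : ℂ) - z := by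
    rw [hsdef, one_div]
    exact cpow_nat_inv_pow _ two_ne_zero
  have hre : 0 < s.re := by
    have him : (log ((a : ℂ) - z) * (1 / 2)).im = arg ((a : ℂ) - z) / 2 := by
      rw [show (1 / 2 : ℂ) = ((1 / 2 : ℝ) : ℂ) by push_cast; rfl, im_mul_ofReal, log_im]
      ring
    rw [hsdef, cpow_def_of_ne_zero hne, exp_re, him]
    have harg := mem_slitPlane_iff_arg.mp hslit
    have hlt : arg ((a : ℂ) - z) < π := (arg_le_pi _).lt_of_ne harg.1
    refine mul_pos (Real.exp_pos _) (Real.cos_pos_of_mem_Ioo ⟨?_, ?_⟩) <;>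
      linarith [neg_pi_lt_arg ((a : ℂ) - z)]
  have hfun : (fun t : ℝ => ((a : ℂ) + (t : ℂ) ^ 2 - z)⁻¹) =
      fun t : ℝ => (s ^ 2 + (t : ℂ) ^ 2)⁻¹ := by
    funext t
    rw [hsq]
    ring
  rw [hfun]
  refine ⟨integrable_inv_sq_add_sq_of_re_pos hre, ?_⟩
  rw [integral_univ_inv_sq_add_sq_of_re_pos hre, cpow_neg, ← hsdef]
  have hpi : (π : ℂ) ≠ 0 := ofReal_ne_zero.mpr pi_ne_zero
  field_simp
end
end

section
/- Let d ≥ 2 be an integer and z ∈ ℂ∖[0,∞). Let g be a Schwartz function on ℝ^{d−1} and define u : ℝ^d → ℂ by u(x) = (2π)^{−d} ∫_{ℝ^d} e^{iξ·x} (|ξ|²−z)^{−1} (𝓕_{d−1}g)(ξ') dξ, where points of ℝ^d are written ξ = (ξ', ξ_d) with ξ' ∈ ℝ^{d−1}. Then the defining integral converges absolutely and for every x' ∈ ℝ^{d−1}, u(x',0) = (1/2) (2π)^{−(d−1)} ∫_{ℝ^{d−1}} e^{iξ'·x'} (|ξ'|²−z)^{−1/2} (𝓕_{d−1}g)(ξ')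 dξ'. In other words, Γ(−Δ−z)^{−1}Γ* = (1/2)(−Δ'−z)^{−1/2}, where Γ is the operator restricting a function on ℝ^d to the hyperplane x_d = 0 and −Δ' is the Laplacian on ℝ^{d−1}. -/
open MeasureTheory Complex Filter Real RealInnerProductSpace

noncomputable section

/-- On the resolvent set `ℂ \ [0,∞)` the resolvent `(s - z)⁻¹` decays like `(1 + s)⁻¹`. -/
lemma exists_norm_inv_ofReal_sub_le {z : ℂ} (hz : ¬ (z.im = 0 ∧ 0 ≤ z.re)) :
    ∃ C : ℝ, 0 ≤ C ∧ ∀ s : ℝ, 0 ≤ s → ‖((s : ℂ) - z)⁻¹‖ ≤ C * (1 + s)⁻¹ := by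
  obtain ⟨δ, hδ, hδs⟩ : ∃ δ : ℝ, 0 < δ ∧ ∀ s : ℝ, 0 ≤ s → δ ≤ ‖(s : ℂ) - z‖ := by
    by_cases him : z.im = 0
    · have hre : z.re < 0 := by
        by_contra h
        exact hz ⟨him, not_lt.mp h⟩
      refine ⟨-z.re, by linarith, fun s hs => ?_⟩
      have h := Complex.re_le_norm ((s : ℂ) - z)
      simp only [Complex.sub_re, Complex.ofReal_re] at h
      linarith
    · refine ⟨|z.im|, abs_pos.mpr him, fun s _ => ?_⟩
      simpa using Complex.abs_im_le_norm ((s : ℂ) - z)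
  refine ⟨(1 + ‖z‖) / δ + 1, by positivity, fun s hs => ?_⟩
  have hpos : 0 < ‖(s : ℂ) - z‖ := hδ.trans_le (hδs s hs)
  have hs' : s ≤ ‖(s : ℂ) - z‖ + ‖z‖ := by
    simpa [abs_of_nonneg hs] using norm_add_le ((s : ℂ) - z) z
  have hz' : 1 + ‖z‖ ≤ (1 + ‖z‖) / δ * ‖(s : ℂ) - z‖ := by
    rw [div_mul_eq_mul_div, le_div_iff₀ hδ]
    exact mul_le_mul_of_nonneg_left (hδs s hs) (by positivity)
  rw [norm_inv, ← div_eq_mul_inv, inv_eq_one_div, div_le_div_iff₀ hpos (by positivity)]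
  linarith

lemma ofReal_sub_mem_slitPlane {z : ℂ} (hz : ¬ (z.im = 0 ∧ 0 ≤ z.re)) {s : ℝ} (hs : 0 ≤ s) :
    (s : ℂ) - z ∈ Complex.slitPlane := by
  rw [Complex.mem_slitPlane_iff]
  by_cases him : z.im = 0
  · left
    have hre : z.re < 0 := by
      by_contra h
      exact hz ⟨him, not_lt.mp h⟩
    simp only [Complex.sub_re, Complex.ofReal_re]
    linarith
  · right
    simpa using him

lemma integrable_inv_sq_sub {z : ℂ} (hz : ¬ (z.im = 0 ∧ 0 ≤ z.re)) :
    Integrable (fun t : ℝ => (((t ^ 2 : ℝ) : ℂ) - z)⁻¹) := by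
  obtain ⟨C, -, hC⟩ := exists_norm_inv_ofReal_sub_le hz
  refine (integrable_inv_one_add_sq.const_mul C).mono' ?_
    (Eventually.of_forall fun t => hC _ (sq_nonneg t))
  refine (Continuous.inv₀ (by fun_prop) fun t => ?_).aestronglyMeasurable
  exact Complex.slitPlane_ne_zero (ofReal_sub_mem_slitPlane hz (sq_nonneg t))

lemma add_ofReal_mul_I_mem_slitPlane {a : ℂ} (ha : 0 < a.re) (t : ℝ) :
    a + t * I ∈ Complex.slitPlane := by
  left
  simpa using ha

lemma tendsto_log_add_sub_log_sub_atTop {a : ℂ} (ha : 0 < a.re) :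
    Tendsto (fun t : ℝ => Complex.log (a + t * I) - Complex.log (a - t * I)) atTop
      (nhds (π * I)) := by
  have h0 : Tendsto (fun t : ℝ => a * ((t⁻¹ : ℝ) : ℂ)) atTop (nhds 0) := by
    simpa using ((Complex.continuous_ofReal.tendsto 0).comp tendsto_inv_atTop_zero).const_mul a
  have h1 : Tendsto (fun t : ℝ => Complex.log (a * ((t⁻¹ : ℝ) : ℂ) + I)) atTop
      (nhds (Complex.log I)) := by
    refine Filter.Tendsto.clog ?_ (by simp [Complex.mem_slitPlane_iff])
    simpa using h0.add_const I
  have h2 : Tendsto (fun t : ℝ => Complex.log (a * ((t⁻¹ : ℝ) : ℂ) - I)) atTop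
      (nhds (Complex.log (-I))) := by
    refine Filter.Tendsto.clog ?_ (by simp [Complex.mem_slitPlane_iff])
    simpa using h0.sub_const I
  have h3 := h1.sub h2
  rw [Complex.log_I, Complex.log_neg_I] at h3
  have h4 : (π / 2 * I - -(π / 2) * I : ℂ) = π * I := by ring
  rw [h4] at h3
  refine h3.congr' ?_
  filter_upwards [eventually_gt_atTop 0] with t ht
  have htc : (t : ℂ) ≠ 0 := by exact_mod_cast ht.ne'
  have hp : (a + t * I : ℂ) = t * (a * ((t⁻¹ : ℝ) : ℂ) + I) := by
    push_cast
    field_simp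
  have hm : (a - t * I : ℂ) = t * (a * ((t⁻¹ : ℝ) : ℂ) - I) := by
    push_cast
    field_simp
  have hre : 0 < (a * ((t⁻¹ : ℝ) : ℂ)).re := by
    rw [Complex.re_mul_ofReal]
    positivity
  have hpne : a * ((t⁻¹ : ℝ) : ℂ) + I ≠ 0 := by
    intro h
    have := congrArg Complex.re h
    rw [Complex.add_re, Complex.I_re, Complex.zero_re] at this
    linarith
  have hmne : a * ((t⁻¹ : ℝ) : ℂ) - I ≠ 0 := by
    intro h
    have := congrArg Complex.re h
    rw [Complex.sub_re, Complex.I_re, Complex.zero_re] at this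
    linarith
  rw [hp, hm, Complex.log_ofReal_mul ht hpne, Complex.log_ofReal_mul ht hmne]
  ring

lemma tendsto_log_add_sub_log_sub_atBot {a : ℂ} (ha : 0 < a.re) :
    Tendsto (fun t : ℝ => Complex.log (a + t * I) - Complex.log (a - t * I)) atBot
      (nhds (-(π * I))) := by
  refine (((tendsto_log_add_sub_log_sub_atTop ha).comp tendsto_neg_atBot_atTop).neg).congr
    fun t => ?_
  simp [sub_eq_add_neg]

lemma hasDerivAt_log_add_sub_log_sub {a : ℂ} (ha : 0 < a.re) (t : ℝ) :
    HasDerivAt (fun t : ℝ => (2 * a * I)⁻¹ * (Complex.log (a + t * I) - Complex.log (a - t * I)))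
      ((t : ℂ) ^ 2 + a ^ 2)⁻¹ t := by
  have hp := add_ofReal_mul_I_mem_slitPlane ha t
  have hm : a - t * I ∈ Complex.slitPlane := by
    simpa [sub_eq_add_neg] using add_ofReal_mul_I_mem_slitPlane ha (-t)
  have hI : HasDerivAt (fun t : ℝ => (t : ℂ) * I) I t := by
    simpa using (Complex.ofRealCLM.hasDerivAt (x := t)).mul_const I
  refine ((((hI.const_add a).clog_real hp).sub ((hI.const_sub a).clog_real hm)).const_mul
    (2 * a * I)⁻¹).congr_deriv ?_
  have hp0 := Complex.slitPlane_ne_zero hp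
  have hm0 := Complex.slitPlane_ne_zero hm
  have ha0 : a ≠ 0 := by
    rintro rfl
    simp at ha
  have hfac : (t : ℂ) ^ 2 + a ^ 2 = (a + t * I) * (a - t * I) := by
    ring_nf
    simp [Complex.I_sq, add_comm]
  rw [hfac, div_sub_div _ _ hp0 hm0, div_eq_mul_inv,
    inv_mul_eq_iff_eq_mul₀ (mul_ne_zero (mul_ne_zero two_ne_zero ha0) Complex.I_ne_zero)]
  congr 1
  ring

/-- `∫ dt / (t² + w) = π w^{-1/2}` for `w = -z` off the negative half-line. -/
lemma integral_inv_sq_sub {z : ℂ} (hz : ¬ (z.im = 0 ∧ 0 ≤ z.re)) :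
    ∫ t : ℝ, (((t ^ 2 : ℝ) : ℂ) - z)⁻¹ = π * (-z) ^ (-(1 / 2) : ℂ) := by
  have hw : -z ∈ Complex.slitPlane := by
    simpa using ofReal_sub_mem_slitPlane hz le_rfl
  have hw0 := Complex.slitPlane_ne_zero hw
  set a : ℂ := (-z) ^ (1 / 2 : ℂ) with ha_def
  have ha_sq : a ^ 2 = -z := by
    rw [ha_def, ← Complex.cpow_nat_mul]
    norm_num
  have ha : 0 < a.re := by
    have hcast : (1 / 2 : ℂ) = ((1 / 2 : ℝ) : ℂ) := by norm_num
    rw [ha_def, hcast, Complex.cpow_ofReal_re]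
    have harg := Complex.mem_slitPlane_iff_arg.mp hw
    have h1 := Complex.neg_pi_lt_arg (-z)
    have h2 := lt_of_le_of_ne (Complex.arg_le_pi (-z)) harg.1
    exact mul_pos (Real.rpow_pos_of_pos (norm_pos_iff.mpr hw0) _)
      (Real.cos_pos_of_mem_Ioo ⟨by linarith, by linarith⟩)
  have ha0 : a ≠ 0 := by
    intro h
    simp [h] at ha
  have hint := integrable_inv_sq_sub hz
  have heq : (fun t : ℝ => (((t ^ 2 : ℝ) : ℂ) - z)⁻¹) = fun t : ℝ => ((t : ℂ) ^ 2 + a ^ 2)⁻¹ := by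
    funext t
    rw [ha_sq, Complex.ofReal_pow, sub_eq_add_neg]
  rw [heq] at hint ⊢
  rw [integral_of_hasDerivAt_of_tendsto (hasDerivAt_log_add_sub_log_sub ha) hint
    ((tendsto_log_add_sub_log_sub_atBot ha).const_mul _)
    ((tendsto_log_add_sub_log_sub_atTop ha).const_mul _), Complex.cpow_neg, ← ha_def]
  field_simp
  ring

section
variable {V : Type*} [NormedAddCommGroup V] [InnerProductSpace ℝ V] [FiniteDimensional ℝ V]
  [MeasurableSpace V] [BorelSpace V]

open scoped FourierTransform

lemma integral_cexp_neg_inner_mul_eq_fourier (g : SchwartzMap V ℂ) (ξ : V) :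
    ∫ y : V, Complex.exp (-Complex.I * (⟪ξ, y⟫ : ℝ)) * g y
      = (𝓕 g : SchwartzMap V ℂ) ((2 * π)⁻¹ • ξ) := by
  rw [SchwartzMap.fourier_coe, Real.fourier_eq']
  refine integral_congr_ae (Eventually.of_forall fun y => ?_)
  simp only [smul_eq_mul]
  congr 2
  rw [inner_smul_right, real_inner_comm]
  push_cast
  have : (π : ℂ) ≠ 0 := by exact_mod_cast Real.pi_ne_zero
  field_simp

lemma continuous_integral_cexp_neg_inner_mul (g : SchwartzMap V ℂ) :
    Continuous fun ξ : V => ∫ y : V, Complex.exp (-Complex.I * (⟪ξ, y⟫ : ℝ)) * g y := by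
  simp_rw [integral_cexp_neg_inner_mul_eq_fourier]
  exact (𝓕 g : SchwartzMap V ℂ).continuous.comp (continuous_const_smul _)

lemma integrable_integral_cexp_neg_inner_mul (g : SchwartzMap V ℂ) :
    Integrable fun ξ : V => ∫ y : V, Complex.exp (-Complex.I * (⟪ξ, y⟫ : ℝ)) * g y := by
  simp_rw [integral_cexp_neg_inner_mul_eq_fourier]
  exact (𝓕 g : SchwartzMap V ℂ).integrable.comp_smul (by positivity)

lemma integrable_cexp_mul_resolvent_mul {z : ℂ} (hz : ¬ (z.im = 0 ∧ 0 ≤ z.re)) {h : V → ℂ}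
    (hc : Continuous h) (hi : Integrable h) (x : V × ℝ) :
    Integrable fun ξ : V × ℝ =>
      Complex.exp (Complex.I * (((⟪ξ.1, x.1⟫ : ℝ) + ξ.2 * x.2 : ℝ) : ℂ)) *
        (((‖ξ.1‖^2 + ξ.2^2 : ℝ) : ℂ) - z)⁻¹ * h ξ.1 := by
  obtain ⟨C, hC0, hC⟩ := exists_norm_inv_ofReal_sub_le hz
  have hdom : Integrable fun ξ : V × ℝ => ‖h ξ.1‖ * (C * (1 + ξ.2 ^ 2)⁻¹) := by
    rw [Measure.volume_eq_prod]
    exact hi.norm.mul_prod (integrable_inv_one_add_sq.const_mul C)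
  refine hdom.mono' ?_ (Eventually.of_forall fun ξ => ?_)
  · refine Continuous.aestronglyMeasurable ?_
    refine (Continuous.mul (by fun_prop) (Continuous.inv₀ (by fun_prop) fun ξ => ?_)).mul
      (hc.comp continuous_fst)
    exact Complex.slitPlane_ne_zero (ofReal_sub_mem_slitPlane hz (by positivity))
  · rw [norm_mul, norm_mul, mul_comm Complex.I, Complex.norm_exp_ofReal_mul_I, one_mul, mul_comm]
    refine mul_le_mul_of_nonneg_left ((hC _ (by positivity)).trans ?_) (norm_nonneg _)
    gcongr
    nlinarith [sq_nonneg ‖ξ.1‖]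

lemma integral_cexp_mul_resolvent_mul {z : ℂ} (hz : ¬ (z.im = 0 ∧ 0 ≤ z.re)) {h : V → ℂ}
    (hc : Continuous h) (hi : Integrable h) (x' : V) :
    ∫ ξ : V × ℝ, Complex.exp (Complex.I * (((⟪ξ.1, x'⟫ : ℝ) + ξ.2 * 0 : ℝ) : ℂ)) *
        (((‖ξ.1‖^2 + ξ.2^2 : ℝ) : ℂ) - z)⁻¹ * h ξ.1
      = π * ∫ ξ' : V, Complex.exp (Complex.I * ((⟪ξ', x'⟫ : ℝ) : ℂ)) *
        ((((‖ξ'‖^2 : ℝ) : ℂ) - z) ^ (-(1/2) : ℂ)) * h ξ' := by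
  have hint := integrable_cexp_mul_resolvent_mul hz hc hi (x', 0)
  rw [Measure.volume_eq_prod] at hint ⊢
  rw [integral_prod _ hint, ← integral_const_mul]
  refine integral_congr_ae (Eventually.of_forall fun ξ' => ?_)
  have hz' : ¬ ((z - ((‖ξ'‖ ^ 2 : ℝ) : ℂ)).im = 0 ∧ 0 ≤ (z - ((‖ξ'‖ ^ 2 : ℝ) : ℂ)).re) := by
    rw [Complex.sub_im, Complex.sub_re, Complex.ofReal_im, Complex.ofReal_re, sub_zero]
    exact fun h' => hz ⟨h'.1, by nlinarith [sq_nonneg ‖ξ'‖]⟩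
  have hinner := integral_inv_sq_sub hz'
  rw [neg_sub] at hinner
  simp only [mul_zero, add_zero]
  rw [integral_mul_const, integral_const_mul]
  have hshift : ∀ t : ℝ, (((‖ξ'‖ ^ 2 + t ^ 2 : ℝ) : ℂ) - z)⁻¹
      = (((t ^ 2 : ℝ) : ℂ) - (z - ((‖ξ'‖ ^ 2 : ℝ) : ℂ)))⁻¹ := fun t => by
    push_cast
    ring
  simp_rw [hshift]
  rw [hinner]
  ring

end

/-- **Lemma (trace of the resolvent).** For `d ≥ 2`, `z ∈ ℂ \ [0,∞)` and a Schwartz function `g`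
on `ℝ^{d-1}`, the function `u(x) = (2π)^{-d} ∫_{ℝ^d} e^{iξ·x} (|ξ|² - z)⁻¹ (𝓕_{d-1}g)(ξ') dξ`
(i.e. `u = (-Δ - z)⁻¹ Γ* g`) is given by an absolutely convergent integral, and its trace on the
hyperplane `x_d = 0` equals `(1/2)(-Δ' - z)^{-1/2} g`, i.e.
`u(x', 0) = (1/2)(2π)^{-(d-1)} ∫_{ℝ^{d-1}} e^{iξ'·x'} (|ξ'|² - z)^{-1/2} (𝓕_{d-1}g)(ξ') dξ'`.
Here `𝓕_{d-1}g(ξ') = ∫ e^{-iξ'·y'} g(y') dy'`. -/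
theorem statement8 (d : ℕ) (hd : 2 ≤ d) (z : ℂ) (hz : ¬ (z.im = 0 ∧ 0 ≤ z.re))
    (g : SchwartzMap (EuclideanSpace ℝ (Fin (d-1))) ℂ) :
    (∀ x : EuclideanSpace ℝ (Fin (d-1)) × ℝ,
      Integrable (fun ξ : EuclideanSpace ℝ (Fin (d-1)) × ℝ =>
        Complex.exp (Complex.I * (((⟪ξ.1, x.1⟫ : ℝ) + ξ.2 * x.2 : ℝ) : ℂ)) *
          (((‖ξ.1‖^2 + ξ.2^2 : ℝ) : ℂ) - z)⁻¹ *
          (∫ y : EuclideanSpace ℝ (Fin (d-1)),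
            Complex.exp (-Complex.I * (⟪ξ.1, y⟫ : ℝ)) * g y))
        (volume : Measure (EuclideanSpace ℝ (Fin (d-1)) × ℝ))) ∧
    (∀ x' : EuclideanSpace ℝ (Fin (d-1)),
      ((2 * π : ℝ) ^ d)⁻¹ •
        (∫ ξ : EuclideanSpace ℝ (Fin (d-1)) × ℝ,
          Complex.exp (Complex.I * (((⟪ξ.1, x'⟫ : ℝ) + ξ.2 * 0 : ℝ) : ℂ)) *
            (((‖ξ.1‖^2 + ξ.2^2 : ℝ) : ℂ) - z)⁻¹ *
            (∫ y : EuclideanSpace ℝ (Fin (d-1)),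
              Complex.exp (-Complex.I * (⟪ξ.1, y⟫ : ℝ)) * g y))
      = (1/2 : ℂ) *
        (((2 * π : ℝ) ^ (d-1))⁻¹ •
          (∫ ξ' : EuclideanSpace ℝ (Fin (d-1)),
            Complex.exp (Complex.I * ((⟪ξ', x'⟫ : ℝ) : ℂ)) *
              ((((‖ξ'‖^2 : ℝ) : ℂ) - z) ^ (-(1/2) : ℂ)) *
              (∫ y : EuclideanSpace ℝ (Fin (d-1)),
                Complex.exp (-Complex.I * (⟪ξ', y⟫ : ℝ)) * g y)))) := by
  have hc := continuous_integral_cexp_neg_inner_mul g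
  have hi := integrable_integral_cexp_neg_inner_mul g
  refine ⟨integrable_cexp_mul_resolvent_mul hz hc hi, fun x' => ?_⟩
  rw [integral_cexp_mul_resolvent_mul hz hc hi x', Complex.real_smul, Complex.real_smul,
    ← mul_assoc, ← mul_assoc]
  congr 1
  obtain ⟨n, rfl⟩ : ∃ n, d = n + 1 := ⟨d - 1, by omega⟩
  have hπ : (π : ℂ) ≠ 0 := by exact_mod_cast Real.pi_ne_zero
  rw [Nat.add_sub_cancel, pow_succ]
  push_cast
  field_simp
end
end
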